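/- arXiv:2602.19014 — 2 statements merged into one kernel-verified Lean document; each statement's English description precedes it below -/
import Mathlib

section
/- Let Γ be a discrete abelian group and C ⊆ Γ. If K, H ≤ Γ are finite-index subgroups such that K is the stabilizer of C+K, H is the stabilizer of C+H, and d*(C) = d*(C+H) = d*(C+K), then H = K. -/
open scoped Pointwise
open Filter

namespace SumsetMeans

variable (Γ : Type*) [AddCommGroup Γ] [TopologicalSpace Γ] [DiscreteTopology Γ]

/-- The indicator function of `A ⊆ Γ` as a bounded (continuous, since `Γ` is discrete)
real-valued function, i.e. as an element of `ℓ^∞(Γ)`. -/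
noncomputable def ind (A : Set Γ) : BoundedContinuousFunction Γ ℝ :=
  BoundedContinuousFunction.ofNormedAddCommGroup (Set.indicator A 1)
    continuous_of_discreteTopology 1
    (fun x => by by_cases h : x ∈ A <;> simp [Set.indicator_apply, h])

/-- The translate `τ_γ f`, given by `(τ_γ f)(x) = f (x - γ)`. -/
noncomputable def translate (γ : Γ) (f : BoundedContinuousFunction Γ ℝ) :
    BoundedContinuousFunction Γ ℝ :=
  f.compContinuous ⟨fun x => x - γ, continuous_of_discreteTopology⟩

/-- An invariant mean on `ℓ^∞(Γ)`: a linear functional with `m 1 = 1`, nonnegative on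
nonnegative functions, and invariant under all translations. -/
structure IsInvariantMean (m : BoundedContinuousFunction Γ ℝ →ₗ[ℝ] ℝ) : Prop where
  map_one : m 1 = 1
  nonneg : ∀ f : BoundedContinuousFunction Γ ℝ, (∀ x, 0 ≤ f x) → 0 ≤ m f
  invariant : ∀ (γ : Γ) (f : BoundedContinuousFunction Γ ℝ), m (translate Γ γ f) = m f

/-- The value `m(A) := m(1_A)` of a mean on a set `A ⊆ Γ`. -/
noncomputable def mVal (m : BoundedContinuousFunction Γ ℝ →ₗ[ℝ] ℝ) (A : Set Γ) : ℝ :=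
  m (ind Γ A)

/-- Upper Banach density: `d*(A) = sup { m(A) : m an invariant mean on ℓ^∞(Γ) }`. -/
noncomputable def ubd (A : Set Γ) : ℝ :=
  sSup {x : ℝ | ∃ m, IsInvariantMean Γ m ∧ mVal Γ m A = x}

/-- An extreme invariant mean: an extreme point of the convex set of invariant means. -/
def IsExtremeInvariantMean (ν : BoundedContinuousFunction Γ ℝ →ₗ[ℝ] ℝ) : Prop :=
  ν ∈ Set.extremePoints ℝ {m : BoundedContinuousFunction Γ ℝ →ₗ[ℝ] ℝ | IsInvariantMean Γ m}

section InvariantMean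

variable {Γ}

/-- Translation by `γ` as a linear operator on `ℓ^∞(Γ)`. -/
noncomputable def translateLin (γ : Γ) : Module.End ℝ (BoundedContinuousFunction Γ ℝ) where
  toFun := translate Γ γ
  map_add' _ _ := rfl
  map_smul' _ _ := rfl

theorem translateLin_apply (γ : Γ) (f : BoundedContinuousFunction Γ ℝ) (x : Γ) :
    translateLin γ f x = f (x - γ) := rfl

theorem commute_translateLin (γ δ : Γ) :
    Commute (translateLin γ) (translateLin δ) := by
  ext f x
  simp only [Module.End.mul_apply, translateLin_apply, sub_right_comm]

/-- Operators that preserve pointwise lower bounds and lie in the double commutant of the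
translations. -/
structure IsAveraging (A : Module.End ℝ (BoundedContinuousFunction Γ ℝ)) : Prop where
  le_apply : ∀ f (c : ℝ), (∀ x, c ≤ f x) → ∀ x, c ≤ A f x
  commute : ∀ B, (∀ γ : Γ, Commute (translateLin γ) B) → Commute A B

namespace IsAveraging

variable {A B : Module.End ℝ (BoundedContinuousFunction Γ ℝ)}

theorem one : IsAveraging (1 : Module.End ℝ (BoundedContinuousFunction Γ ℝ)) :=
  ⟨fun _ _ h => h, fun B _ => Commute.one_left B⟩

theorem mul (hA : IsAveraging A) (hB : IsAveraging B) : IsAveraging (A * B) :=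
  ⟨fun f c h => hA.le_apply _ c (hB.le_apply f c h),
    fun D hD => (hA.commute D hD).mul_left (hB.commute D hD)⟩

theorem commute_of_isAveraging (hA : IsAveraging A) (hB : IsAveraging B) : Commute A B :=
  hA.commute B fun γ => (hB.commute _ fun δ => commute_translateLin δ γ).symm

theorem abs_apply_le (hA : IsAveraging A) {f : BoundedContinuousFunction Γ ℝ} {c : ℝ}
    (h : ∀ x, |f x| ≤ c) (x : Γ) : |A f x| ≤ c := by
  have h1 := hA.le_apply f (-c) (fun y => (abs_le.1 (h y)).1) x
  have h2 := hA.le_apply (-f) (-c) (fun y => by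
    simpa using (abs_le.1 (h y)).2) x
  rw [map_neg] at h2
  exact abs_le.2 ⟨h1, by simpa using h2⟩

theorem translateLin (γ : Γ) : IsAveraging (translateLin γ) :=
  ⟨fun _ _ h x => h (x - γ), fun _ hB => hB γ⟩

theorem pow (hA : IsAveraging A) (n : ℕ) : IsAveraging (A ^ n) := by
  induction n with
  | zero => simpa using one
  | succ n ih => simpa [pow_succ] using ih.mul hA

theorem cesaro (hA : IsAveraging A) (n : ℕ) :
    IsAveraging (((n : ℝ) + 1)⁻¹ • ∑ i ∈ Finset.range (n + 1), A ^ i) := by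
  have hn : (0 : ℝ) < n + 1 := by positivity
  refine ⟨fun f c h x => ?_, fun B hB => ?_⟩
  · have key : ((n : ℝ) + 1) * c ≤ ∑ i ∈ Finset.range (n + 1), (A ^ i) f x := by
      simpa using Finset.card_nsmul_le_sum (Finset.range (n + 1)) (fun i => (A ^ i) f x) c
        (fun i _ => (hA.pow i).le_apply f c h x)
    rw [LinearMap.smul_apply, LinearMap.sum_apply, BoundedContinuousFunction.smul_apply,
      BoundedContinuousFunction.sum_apply, smul_eq_mul, ← div_eq_inv_mul, le_div_iff₀ hn]
    linarith
  · exact (Commute.sum_left _ _ _ fun i _ => (hA.pow i).commute B hB).smul_left _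

end IsAveraging

variable (Γ) in
/-- The span of all differences `τ_γ f - f`. -/
noncomputable def coboundaries : Submodule ℝ (BoundedContinuousFunction Γ ℝ) :=
  Submodule.span ℝ {g | ∃ (γ : Γ) (f : BoundedContinuousFunction Γ ℝ),
    g = translateLin γ f - f}

theorem exists_isAveraging_abs_le_of_mem_coboundaries {g : BoundedContinuousFunction Γ ℝ}
    (hg : g ∈ coboundaries Γ) :
    ∀ ε > 0, ∃ A, IsAveraging A ∧ ∀ x : Γ, |A g x| ≤ ε := by
  induction hg using Submodule.span_induction with
  | mem g hg =>
    obtain ⟨γ, f, rfl⟩ := hg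
    intro ε hε
    obtain ⟨n, hn⟩ := exists_nat_gt (2 * ‖f‖ / ε)
    refine ⟨_, (IsAveraging.translateLin γ).cesaro n, fun x => ?_⟩
    have hgeom : (∑ i ∈ Finset.range (n + 1), translateLin γ ^ i) (translateLin γ f - f) =
        (translateLin γ ^ (n + 1)) f - f :=
      LinearMap.congr_fun (geom_sum_mul (translateLin γ) (n + 1)) f
    have h1 : |((translateLin γ ^ (n + 1)) f) x| ≤ ‖f‖ :=
      ((IsAveraging.translateLin γ).pow (n + 1)).abs_apply_le (fun y => f.norm_coe_le_norm y) x
    have h2 : |f x| ≤ ‖f‖ := f.norm_coe_le_norm x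
    have hpos : (0 : ℝ) < n + 1 := by positivity
    rw [LinearMap.smul_apply, hgeom, BoundedContinuousFunction.smul_apply, smul_eq_mul, abs_mul,
      abs_of_pos (inv_pos.2 hpos), ← div_eq_inv_mul, div_le_iff₀ hpos,
      BoundedContinuousFunction.sub_apply]
    rw [div_lt_iff₀ hε] at hn
    have h3 := abs_sub ((translateLin γ ^ (n + 1)) f x) (f x)
    nlinarith
  | zero => exact fun ε hε => ⟨1, IsAveraging.one, fun x => by simpa using hε.le⟩
  | add g₁ g₂ _ _ ih₁ ih₂ =>
    intro ε hε
    obtain ⟨A, hA, hA'⟩ := ih₁ (ε / 2) (by positivity)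
    obtain ⟨B, hB, hB'⟩ := ih₂ (ε / 2) (by positivity)
    refine ⟨A * B, hA.mul hB, fun x => ?_⟩
    have h1 : |(A * B) g₁ x| ≤ ε / 2 := by
      rw [(hA.commute_of_isAveraging hB).eq]
      exact hB.abs_apply_le hA' x
    have h2 : |(A * B) g₂ x| ≤ ε / 2 := hA.abs_apply_le hB' x
    rw [map_add, BoundedContinuousFunction.add_apply]
    linarith [abs_add_le ((A * B) g₁ x) ((A * B) g₂ x)]
  | smul a g _ ih =>
    intro ε hε
    obtain ⟨A, hA, hA'⟩ := ih (ε / (|a| + 1)) (by positivity)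
    refine ⟨A, hA, fun x => ?_⟩
    have h := hA' x
    rw [le_div_iff₀ (by positivity)] at h
    rw [map_smul, BoundedContinuousFunction.smul_apply, smul_eq_mul, abs_mul]
    nlinarith [abs_nonneg (A g x)]

theorem exists_lt_of_mem_coboundaries {g : BoundedContinuousFunction Γ ℝ}
    (hg : g ∈ coboundaries Γ) {c : ℝ} (hc : 0 < c) : ∃ x, g x < c := by
  by_contra! h
  obtain ⟨A, hA, hA'⟩ := exists_isAveraging_abs_le_of_mem_coboundaries hg (c / 2) (by positivity)
  linarith [hA.le_apply g c h 0, le_of_abs_le (hA' 0)]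

variable (Γ) in
theorem exists_isInvariantMean : ∃ m, IsInvariantMean Γ m := by
  set S := coboundaries Γ
  let P : PointedCone ℝ (BoundedContinuousFunction Γ ℝ) :=
    { carrier := {f | ∀ x, 0 ≤ f x}
      zero_mem' := fun _ => le_rfl
      smul_mem' := fun c f hf x => mul_nonneg c.2 (hf x)
      add_mem' := fun hf hg x => add_nonneg (hf x) (hg x) }
  have h1 : S.mkQ 1 ≠ 0 := by
    rw [Ne, Submodule.mkQ_apply, Submodule.Quotient.mk_eq_zero]
    intro h
    obtain ⟨x, hx⟩ := exists_lt_of_mem_coboundaries h one_pos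
    simp at hx
  obtain ⟨φ, hφ, hφP⟩ := riesz_extension (PointedCone.map S.mkQ P) (LinearPMap.mkSpanSingleton (S.mkQ 1) 1 h1)
    (by
      rintro ⟨q, hq⟩ hqP
      obtain ⟨c, rfl⟩ := Submodule.mem_span_singleton.1 hq
      erw [LinearPMap.mkSpanSingleton'_apply]
      rw [RingHom.id_apply, smul_eq_mul, mul_one]
      obtain ⟨f, hf, hfq⟩ := hqP
      by_contra! hc
      have hmem : f - c • 1 ∈ S := (Submodule.Quotient.eq S).1 hfq
      obtain ⟨x, hx⟩ := exists_lt_of_mem_coboundaries hmem (neg_pos.2 hc)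
      have := hf x
      simp at hx
      linarith)
    (by
      intro q
      obtain ⟨f, rfl⟩ := S.mkQ_surjective q
      refine ⟨⟨‖f‖ • S.mkQ 1, Submodule.smul_mem _ _ (Submodule.mem_span_singleton_self _)⟩,
        ‖f‖ • 1 + f, fun x => ?_, by simp⟩
      have := neg_le_of_abs_le (f.norm_coe_le_norm x)
      simp
      linarith)
  refine ⟨φ ∘ₗ S.mkQ, ?_, fun f hf => hφP _ ⟨f, hf, rfl⟩, fun γ f => ?_⟩
  · have := hφ ⟨S.mkQ 1, Submodule.mem_span_singleton_self _⟩
    exact this.trans (LinearPMap.mkSpanSingleton'_apply_self _ _ _ _)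
  · rw [LinearMap.comp_apply, LinearMap.comp_apply]
    congr 1
    exact (Submodule.Quotient.eq S).2 (Submodule.subset_span ⟨γ, f, rfl⟩)

end InvariantMean

section Density

variable {Γ}

theorem ind_apply {X : Type*} [TopologicalSpace X] [DiscreteTopology X] (A : Set X) (x : X) :
    ind X A x = A.indicator 1 x := rfl

namespace IsInvariantMean

variable {m : BoundedContinuousFunction Γ ℝ →ₗ[ℝ] ℝ}

theorem mono (hm : IsInvariantMean Γ m) {f g : BoundedContinuousFunction Γ ℝ}
    (h : ∀ x, f x ≤ g x) : m f ≤ m g := by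
  have := hm.nonneg (g - f) fun x => sub_nonneg.2 (h x)
  rwa [map_sub, sub_nonneg] at this

theorem mVal_le_one (hm : IsInvariantMean Γ m) (A : Set Γ) : mVal Γ m A ≤ 1 := by
  rw [← hm.map_one]
  refine hm.mono fun x => ?_
  by_cases h : x ∈ A <;> simp [ind_apply, h]

theorem mVal_le_ubd (hm : IsInvariantMean Γ m) (A : Set Γ) : mVal Γ m A ≤ ubd Γ A :=
  le_csSup ⟨1, by rintro _ ⟨m, hm, rfl⟩; exact hm.mVal_le_one A⟩ ⟨m, hm, rfl⟩

theorem one_le_index_mul_mVal_coset (hm : IsInvariantMean Γ m) (L : AddSubgroup Γ)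
    [L.FiniteIndex] (d : Γ) : 1 ≤ (L.index : ℝ) * mVal Γ m {x | x - d ∈ L} := by
  have := Fintype.ofFinite (Γ ⧸ L)
  set D : Set Γ := {x | x - d ∈ L}
  have hsum : m (∑ q : Γ ⧸ L, translate Γ q.out (ind Γ D)) = L.index * mVal Γ m D := by
    simp [map_sum, hm.invariant, mVal, AddSubgroup.index, Nat.card_eq_fintype_card]
  rw [← hsum, ← hm.map_one]
  refine hm.mono fun x => ?_
  rw [BoundedContinuousFunction.sum_apply]
  have hmem : x - (QuotientAddGroup.mk (x - d) : Γ ⧸ L).out ∈ D := by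
    have := QuotientAddGroup.eq.1 (QuotientAddGroup.out_eq' (QuotientAddGroup.mk (x - d) : Γ ⧸ L))
    change x - _ - d ∈ L
    convert this using 1
    abel
  calc (1 : ℝ) = translate Γ (QuotientAddGroup.mk (x - d) : Γ ⧸ L).out (ind Γ D) x :=
        (Set.indicator_of_mem hmem (1 : Γ → ℝ)).symm
    _ ≤ _ := Finset.single_le_sum
        (f := fun q : Γ ⧸ L => translate Γ q.out (ind Γ D) x)
        (fun q _ => Set.indicator_nonneg (fun _ _ => zero_le_one) (x - q.out))
        (Finset.mem_univ _)

end IsInvariantMean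

/-- Adding a coset of a finite-index subgroup strictly increases the upper Banach density. -/
theorem ubd_lt_ubd_of_coset {A B : Set Γ} (L : AddSubgroup Γ) [L.FiniteIndex] (d : Γ)
    (hAB : A ⊆ B) (hd : ∀ x, x - d ∈ L → x ∈ B \ A) : ubd Γ A < ubd Γ B := by
  have hpos : (0 : ℝ) < L.index := by
    exact_mod_cast Nat.pos_of_ne_zero AddSubgroup.FiniteIndex.index_ne_zero
  have hle : ubd Γ A ≤ ubd Γ B - (L.index : ℝ)⁻¹ := by
    obtain ⟨m₀, hm₀⟩ := exists_isInvariantMean Γ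
    refine csSup_le ⟨_, m₀, hm₀, rfl⟩ ?_
    rintro _ ⟨m, hm, rfl⟩
    have hcoset := hm.one_le_index_mul_mVal_coset L d
    rw [← inv_le_iff_one_le_mul₀' hpos] at hcoset
    have hadd : mVal Γ m A + mVal Γ m {x | x - d ∈ L} ≤ mVal Γ m B := by
      rw [mVal, mVal, ← map_add]
      refine hm.mono fun x => ?_
      rw [BoundedContinuousFunction.add_apply]
      by_cases hx : x - d ∈ L
      · simp [ind_apply, hx, (hd x hx).1, (hd x hx).2]
      · by_cases hxA : x ∈ A
        · simp [ind_apply, hx, hxA, hAB hxA]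
        · simpa [ind_apply, hx, hxA] using Set.indicator_nonneg (f := (1 : Γ → ℝ)) (fun _ _ => zero_le_one) x
    linarith [hm.mVal_le_ubd B]
  linarith [inv_pos.2 hpos]

theorem add_mem_add_addSubgroup {G : Type*} [AddCommGroup G] {C : Set G} {K : AddSubgroup G}
    {x k : G} (hx : x ∈ C + (K : Set G)) (hk : k ∈ K) : x + k ∈ C + (K : Set G) := by
  obtain ⟨c, hc, l, hl, rfl⟩ := hx
  exact ⟨c, hc, l + k, K.add_mem hl hk, (add_assoc _ _ _).symm⟩

theorem subset_add_addSubgroup {G : Type*} [AddCommGroup G] (C : Set G) (K : AddSubgroup G) :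
    C ⊆ C + (K : Set G) :=
  Set.subset_add_left C K.zero_mem

theorem add_subset_add_of_ubd_eq {C : Set Γ} {K : AddSubgroup Γ} (H : AddSubgroup Γ)
    [K.FiniteIndex] [H.FiniteIndex] (h : ubd Γ C = ubd Γ (C + (K : Set Γ))) :
    C + (K : Set Γ) ⊆ C + (H : Set Γ) := by
  intro d hdK
  by_contra hdH
  refine (ubd_lt_ubd_of_coset (K ⊓ H) d (subset_add_addSubgroup C K) fun x hx => ?_).ne h
  obtain ⟨hxK, hxH⟩ := hx
  refine ⟨by simpa using add_mem_add_addSubgroup hdK hxK, fun hxC => hdH ?_⟩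
  simpa using add_mem_add_addSubgroup (subset_add_addSubgroup C H hxC) (H.neg_mem hxH)

end Density

theorem stabilizer_unique (C : Set Γ) (K H : AddSubgroup Γ)
    (hKfi : K.FiniteIndex) (hHfi : H.FiniteIndex)
    (hKstab : (K : Set Γ) =
      {γ : Γ | C + (K : Set Γ) + {γ} = C + (K : Set Γ)})
    (hHstab : (H : Set Γ) =
      {γ : Γ | C + (H : Set Γ) + {γ} = C + (H : Set Γ)})
    (h1 : ubd Γ C = ubd Γ (C + (H : Set Γ)))
    (h2 : ubd Γ C = ubd Γ (C + (K : Set Γ))) :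
    H = K := by
  have hKH : C + (K : Set Γ) = C + (H : Set Γ) :=
    (add_subset_add_of_ubd_eq H h2).antisymm (add_subset_add_of_ubd_eq K h1)
  rw [← SetLike.coe_set_eq, hHstab, hKstab, hKH]

end SumsetMeans
end

section
/- Let Γ be a discrete abelian group, m a mean on ℓ^∞(Γ), and let f_n : Γ → [0,1] (n ∈ ℕ) satisfy lim_{N→∞} sup_{n,n'≥N} m(|f_n − f_{n'}|²) = 0. For x ∈ [0,1] set C_n(x) := {γ ∈ Γ : f_n(γ) ≤ x} and φ_n(x) := m(C_n(x)). Then there is a countable set Ω ⊆ [0,1] such that: (1) for every x ∈ [0,1] \ Ω, the limit φ(x) := lim_{n→∞} φ_n(x) exists and the function φ is continuous at x; (2) for every b ∈ [0,1] \ Ω, lim_{N→∞} sup_{n,n'≥N} m(C_n(b) Δ C_{n'}(b)) = 0; (3) if in addition lim_{n→∞} m(|f_n − τ_γ f_n|²) = 0 for every γ ∈ Γ, then lim_{n→∞} m(C_n(b) Δ (C_n(b) + γ)) = 0 for every γ ∈ Γ and every b ∈ [0,1] \ Ω; (4) for every b ∈ [0,1] \ Ω, setting D_n(b) := {γ ∈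 Γ : f_n(γ) < b}, one has lim_{n→∞} m(C_n(b) Δ D_n(b)) = 0. -/
open scoped Pointwise
open Filter

namespace SumsetMeans

variable (Γ : Type*) [AddCommGroup Γ] [TopologicalSpace Γ] [DiscreteTopology Γ]

/-- A (not necessarily invariant) mean on `ℓ^∞(Γ)`: a linear functional with `m 1 = 1`
that is nonnegative on nonnegative functions. -/
structure IsMean (m : BoundedContinuousFunction Γ ℝ →ₗ[ℝ] ℝ) : Prop where
  map_one : m 1 = 1
  nonneg : ∀ f : BoundedContinuousFunction Γ ℝ, (∀ x, 0 ≤ f x) → 0 ≤ m f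

section Aux

variable {Γ : Type*} [AddCommGroup Γ] [TopologicalSpace Γ] [DiscreteTopology Γ]
  {m : BoundedContinuousFunction Γ ℝ →ₗ[ℝ] ℝ}

open scoped Classical in
lemma ind_apply_s18 (A : Set Γ) (x : Γ) : ind Γ A x = if x ∈ A then 1 else 0 :=
  Set.indicator_apply A 1 x

lemma IsMean.mono (hm : IsMean Γ m) {f g : BoundedContinuousFunction Γ ℝ}
    (h : ∀ x, f x ≤ g x) : m f ≤ m g := by
  have := hm.nonneg (g - f) fun x => by simpa using h x
  rw [map_sub] at this
  linarith

lemma IsMean.mVal_nonneg (hm : IsMean Γ m) (A : Set Γ) : 0 ≤ mVal Γ m A :=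
  hm.nonneg _ fun x => Set.indicator_nonneg (fun _ _ => zero_le_one) x

lemma IsMean.mVal_mono (hm : IsMean Γ m) {A B : Set Γ} (h : A ⊆ B) :
    mVal Γ m A ≤ mVal Γ m B :=
  hm.mono fun x => Set.indicator_le_indicator_of_subset h (fun _ => zero_le_one) x

lemma IsMean.mVal_le_one (hm : IsMean Γ m) (A : Set Γ) : mVal Γ m A ≤ 1 := by
  rw [← hm.map_one]
  exact hm.mono fun x => Set.indicator_le_self' (fun _ _ => zero_le_one) x

lemma inv_sq_mul_sq_ge_one {δ t : ℝ} (hδ : 0 < δ) (h : δ ≤ |t|) : 1 ≤ (δ ^ 2)⁻¹ * (t * t) := by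
  have : δ ^ 2 ≤ t * t := by rw [← sq, ← sq_abs t]; gcongr
  rw [inv_mul_eq_div, le_div_iff₀ (by positivity)]
  linarith

/-- Chebyshev-type comparison of sublevel sets of two functions. -/
lemma IsMean.mVal_sublevel_le (hm : IsMean Γ m) (f g : BoundedContinuousFunction Γ ℝ) (b : ℝ)
    {δ : ℝ} (hδ : 0 < δ) :
    mVal Γ m {x | f x ≤ b} ≤
      mVal Γ m {x | g x ≤ b + δ} + (δ ^ 2)⁻¹ * m ((f - g) * (f - g)) := by
  have h := hm.mono (f := ind Γ {x | f x ≤ b})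
    (g := ind Γ {x | g x ≤ b + δ} + (δ ^ 2)⁻¹ • ((f - g) * (f - g))) ?_
  · simpa only [mVal, map_add, map_smul, smul_eq_mul] using h
  intro x
  have h0 : 0 ≤ (δ ^ 2)⁻¹ * ((f x - g x) * (f x - g x)) :=
    mul_nonneg (by positivity) (mul_self_nonneg _)
  simp only [BoundedContinuousFunction.coe_add, BoundedContinuousFunction.coe_smul,
    BoundedContinuousFunction.coe_mul, BoundedContinuousFunction.coe_sub, Pi.add_apply,
    Pi.mul_apply, Pi.sub_apply, smul_eq_mul, ind_apply_s18, Set.mem_ofPred_eq]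
  by_cases h1 : δ ≤ |f x - g x|
  · have := inv_sq_mul_sq_ge_one hδ h1
    split_ifs <;> linarith
  · have := abs_lt.1 (not_le.1 h1)
    split_ifs <;> linarith

lemma IsMean.mVal_symmDiff_sublevel_le (hm : IsMean Γ m) (f g : BoundedContinuousFunction Γ ℝ)
    (b : ℝ) {δ : ℝ} (hδ : 0 < δ) :
    mVal Γ m (symmDiff {x | f x ≤ b} {x | g x ≤ b}) ≤
      mVal Γ m {x | f x ≤ b + δ} - mVal Γ m {x | f x ≤ b - δ} +
        (δ ^ 2)⁻¹ * m ((f - g) * (f - g)) := by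
  have h := hm.mono (f := ind Γ (symmDiff {x | f x ≤ b} {x | g x ≤ b}))
    (g := ind Γ {x | f x ≤ b + δ} - ind Γ {x | f x ≤ b - δ} +
      (δ ^ 2)⁻¹ • ((f - g) * (f - g))) ?_
  · simpa only [mVal, map_add, map_sub, map_smul, smul_eq_mul] using h
  intro x
  have h0 : 0 ≤ (δ ^ 2)⁻¹ * ((f x - g x) * (f x - g x)) :=
    mul_nonneg (by positivity) (mul_self_nonneg _)
  simp only [BoundedContinuousFunction.coe_add, BoundedContinuousFunction.coe_smul,
    BoundedContinuousFunction.coe_mul, BoundedContinuousFunction.coe_sub, Pi.add_apply,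
    Pi.mul_apply, Pi.sub_apply, smul_eq_mul, ind_apply_s18, Set.mem_symmDiff,
    Set.mem_ofPred_eq]
  by_cases h1 : δ ≤ |f x - g x|
  · have := inv_sq_mul_sq_ge_one hδ h1
    split_ifs <;> linarith
  · have := abs_lt.1 (not_le.1 h1)
    split_ifs <;> grind

lemma IsMean.mVal_symmDiff_sublevel_strict_le (hm : IsMean Γ m)
    (f : BoundedContinuousFunction Γ ℝ) (b : ℝ) {δ : ℝ} (hδ : 0 < δ) :
    mVal Γ m (symmDiff {x | f x ≤ b} {x | f x < b}) ≤
      mVal Γ m {x | f x ≤ b + δ} - mVal Γ m {x | f x ≤ b - δ} := by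
  have h := hm.mono (f := ind Γ (symmDiff {x | f x ≤ b} {x | f x < b}))
    (g := ind Γ {x | f x ≤ b + δ} - ind Γ {x | f x ≤ b - δ}) ?_
  · simpa only [mVal, map_sub] using h
  intro x
  simp only [BoundedContinuousFunction.coe_sub, Pi.sub_apply, ind_apply_s18, Set.mem_symmDiff,
    Set.mem_ofPred_eq]
  split_ifs <;> grind

/-- The upper distribution function `x ↦ limsup m {f_n ≤ x}` of a sequence of functions. -/
noncomputable def upperDistribution (m : BoundedContinuousFunction Γ ℝ →ₗ[ℝ] ℝ)
    (f : ℕ → BoundedContinuousFunction Γ ℝ) (x : ℝ) : ℝ :=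
  limsup (fun n => mVal Γ m {γ | f n γ ≤ x}) atTop

section Sequence

variable {f : ℕ → BoundedContinuousFunction Γ ℝ}

lemma IsMean.isBoundedUnder_le_mVal (hm : IsMean Γ m) (A : ℕ → Set Γ) :
    IsBoundedUnder (· ≤ ·) atTop fun n => mVal Γ m (A n) :=
  isBoundedUnder_of ⟨1, fun n => hm.mVal_le_one (A n)⟩

lemma IsMean.isCoboundedUnder_le_mVal (hm : IsMean Γ m) (A : ℕ → Set Γ) :
    IsCoboundedUnder (· ≤ ·) atTop fun n => mVal Γ m (A n) :=
  IsBoundedUnder.isCoboundedUnder_le (isBoundedUnder_of ⟨0, fun n => hm.mVal_nonneg (A n)⟩)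

lemma IsMean.monotone_upperDistribution (hm : IsMean Γ m) : Monotone (upperDistribution m f) :=
  fun _ _ hxy => limsup_le_limsup
    (Eventually.of_forall fun _ => hm.mVal_mono fun _ hz => le_trans hz hxy)
    (hm.isCoboundedUnder_le_mVal _) (hm.isBoundedUnder_le_mVal _)

lemma IsMean.eventually_mVal_lt (hm : IsMean Γ m) (y : ℝ) {ε : ℝ} (hε : 0 < ε) :
    ∀ᶠ n in atTop, mVal Γ m {γ | f n γ ≤ y} < upperDistribution m f y + ε :=
  eventually_lt_of_limsup_lt (lt_add_of_pos_right _ hε) (hm.isBoundedUnder_le_mVal _)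

variable (hCauchy : ∀ ε : ℝ, 0 < ε → ∃ N : ℕ, ∀ n n' : ℕ, N ≤ n → N ≤ n' →
  m ((f n - f n') * (f n - f n')) < ε)
include hCauchy

lemma IsMean.eventually_lt_mVal (hm : IsMean Γ m) {y z : ℝ} (hyz : y < z) {ε : ℝ} (hε : 0 < ε) :
    ∀ᶠ n in atTop, upperDistribution m f y - ε < mVal Γ m {γ | f n γ ≤ z} := by
  have hδ : 0 < z - y := sub_pos.2 hyz
  obtain ⟨N, hN⟩ := hCauchy ((z - y) ^ 2 * (ε / 2)) (by positivity)
  obtain ⟨k, hk, hkN⟩ := ((frequently_lt_of_lt_limsup (hm.isCoboundedUnder_le_mVal _)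
    (show upperDistribution m f y - ε / 2 < upperDistribution m f y by linarith)).and_eventually
    (eventually_ge_atTop N)).exists
  filter_upwards [eventually_ge_atTop N] with n hn
  have h1 := hm.mVal_sublevel_le (f k) (f n) y hδ
  have h2 : ((z - y) ^ 2)⁻¹ * m ((f k - f n) * (f k - f n)) < ε / 2 := by
    rw [inv_mul_lt_iff₀ (by positivity)]
    exact hN k n hkN hn
  rw [add_sub_cancel] at h1
  linarith

variable {b : ℝ} (hb : ContinuousAt (upperDistribution m f) b)
include hb

lemma IsMean.exists_eventually_mVal_sub_lt (hm : IsMean Γ m) {ε : ℝ} (hε : 0 < ε) :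
    ∃ δ > 0, ∀ᶠ n in atTop,
      mVal Γ m {γ | f n γ ≤ b + δ} - mVal Γ m {γ | f n γ ≤ b - δ} < ε := by
  obtain ⟨δ, hδ, h⟩ := Metric.continuousAt_iff.1 hb (ε / 4) (by positivity)
  have h1 := h (x := b + δ / 3) (by rw [Real.dist_eq, abs_lt]; constructor <;> linarith)
  have h2 := h (x := b - δ / 2) (by rw [Real.dist_eq, abs_lt]; constructor <;> linarith)
  rw [Real.dist_eq, abs_lt] at h1 h2
  refine ⟨δ / 3, by positivity, ?_⟩
  filter_upwards [hm.eventually_mVal_lt (f := f) (b + δ / 3) (show 0 < ε / 4 by positivity),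
    hm.eventually_lt_mVal hCauchy (show b - δ / 2 < b - δ / 3 by linarith)
      (show 0 < ε / 4 by positivity)] with n h3 h4
  linarith [h1.2, h2.1]

lemma IsMean.tendsto_mVal_upperDistribution (hm : IsMean Γ m) :
    Tendsto (fun n => mVal Γ m {γ | f n γ ≤ b}) atTop (nhds (upperDistribution m f b)) := by
  rw [tendsto_order]
  refine ⟨fun a ha => ?_, fun a ha => ?_⟩
  · obtain ⟨c, hac, hcb⟩ := exists_between ha
    obtain ⟨y, hy, hyb⟩ := (((hb.eventually_const_lt hcb).filter_mono
      nhdsWithin_le_nhds).and (self_mem_nhdsWithin (s := Set.Iio b))).exists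
    filter_upwards [hm.eventually_lt_mVal hCauchy hyb (sub_pos.2 hac)] with n hn
    linarith
  · filter_upwards [hm.eventually_mVal_lt (f := f) b (sub_pos.2 ha)] with n hn
    linarith

lemma IsMean.tendsto_mVal_symmDiff_sublevel (hm : IsMean Γ m)
    {g : ℕ → BoundedContinuousFunction Γ ℝ}
    (hg : Tendsto (fun n => m ((f n - g n) * (f n - g n))) atTop (nhds 0)) :
    Tendsto (fun n => mVal Γ m (symmDiff {x | f n x ≤ b} {x | g n x ≤ b})) atTop (nhds 0) := by
  rw [tendsto_order]
  refine ⟨fun a ha => Eventually.of_forall fun n => ha.trans_le (hm.mVal_nonneg _),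
    fun ε hε => ?_⟩
  obtain ⟨δ, hδ, h⟩ := hm.exists_eventually_mVal_sub_lt hCauchy hb (half_pos hε)
  filter_upwards [h, hg.eventually_lt_const (show 0 < δ ^ 2 * (ε / 2) by positivity)]
    with n h1 h2
  rw [← inv_mul_lt_iff₀ (by positivity)] at h2
  linarith [hm.mVal_symmDiff_sublevel_le (f n) (g n) b hδ]

lemma IsMean.tendsto_mVal_symmDiff_sublevel_strict (hm : IsMean Γ m) :
    Tendsto (fun n => mVal Γ m (symmDiff {x | f n x ≤ b} {x | f n x < b})) atTop (nhds 0) := by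
  rw [tendsto_order]
  refine ⟨fun a ha => Eventually.of_forall fun n => ha.trans_le (hm.mVal_nonneg _),
    fun ε hε => ?_⟩
  obtain ⟨δ, hδ, h⟩ := hm.exists_eventually_mVal_sub_lt hCauchy hb hε
  filter_upwards [h] with n h1
  exact (hm.mVal_symmDiff_sublevel_strict_le (f n) b hδ).trans_lt h1

lemma IsMean.exists_forall_mVal_symmDiff_sublevel_lt (hm : IsMean Γ m) {ε : ℝ} (hε : 0 < ε) :
    ∃ N : ℕ, ∀ n n' : ℕ, N ≤ n → N ≤ n' →
      mVal Γ m (symmDiff {γ | f n γ ≤ b} {γ | f n' γ ≤ b}) < ε := by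
  obtain ⟨δ, hδ, h⟩ := hm.exists_eventually_mVal_sub_lt hCauchy hb (half_pos hε)
  obtain ⟨N₁, hN₁⟩ := eventually_atTop.1 h
  obtain ⟨N₂, hN₂⟩ := hCauchy (δ ^ 2 * (ε / 2)) (by positivity)
  refine ⟨max N₁ N₂, fun n n' hn hn' => ?_⟩
  have h2 := hN₂ n n' (le_of_max_le_right hn) (le_of_max_le_right hn')
  rw [← inv_mul_lt_iff₀ (by positivity)] at h2
  linarith [hm.mVal_symmDiff_sublevel_le (f n) (f n') b hδ, hN₁ n (le_of_max_le_left hn)]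

end Sequence

lemma sublevel_add_singleton (f : BoundedContinuousFunction Γ ℝ) (b : ℝ) (γ : Γ) :
    {x | f x ≤ b} + ({γ} : Set Γ) = {x | translate Γ γ f x ≤ b} := by
  ext x
  rw [Set.add_singleton, Set.mem_image]
  exact ⟨by rintro ⟨y, hy, rfl⟩; simpa [translate] using hy,
    fun hx => ⟨x - γ, hx, sub_add_cancel x γ⟩⟩

end Aux

theorem level_sets_of_L2_cauchy
    (m : BoundedContinuousFunction Γ ℝ →ₗ[ℝ] ℝ) (hm : IsMean Γ m)
    (f : ℕ → BoundedContinuousFunction Γ ℝ)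
    (hrange : ∀ n x, f n x ∈ Set.Icc (0 : ℝ) 1)
    (hCauchy : ∀ ε : ℝ, 0 < ε → ∃ N : ℕ, ∀ n n' : ℕ, N ≤ n → N ≤ n' →
      m ((f n - f n') * (f n - f n')) < ε) :
    ∃ Ω : Set ℝ, Ω.Countable ∧
      (∃ φ : ℝ → ℝ, ∀ x ∈ Set.Icc (0 : ℝ) 1 \ Ω,
        Tendsto (fun n => mVal Γ m {γ : Γ | f n γ ≤ x}) atTop (nhds (φ x)) ∧
        ContinuousWithinAt φ (Set.Icc (0 : ℝ) 1) x) ∧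
      (∀ b ∈ Set.Icc (0 : ℝ) 1 \ Ω, ∀ ε : ℝ, 0 < ε → ∃ N : ℕ, ∀ n n' : ℕ, N ≤ n → N ≤ n' →
        mVal Γ m (symmDiff {γ : Γ | f n γ ≤ b} {γ : Γ | f n' γ ≤ b}) < ε) ∧
      ((∀ γ : Γ, Tendsto
          (fun n => m ((f n - translate Γ γ (f n)) * (f n - translate Γ γ (f n))))
          atTop (nhds 0)) →
        ∀ b ∈ Set.Icc (0 : ℝ) 1 \ Ω, ∀ γ : Γ,
          Tendsto (fun n => mVal Γ m
              (symmDiff {x : Γ | f n x ≤ b} ({x : Γ | f n x ≤ b} + ({γ} : Set Γ))))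
            atTop (nhds 0)) ∧
      (∀ b ∈ Set.Icc (0 : ℝ) 1 \ Ω,
        Tendsto (fun n => mVal Γ m (symmDiff {x : Γ | f n x ≤ b} {x : Γ | f n x < b}))
          atTop (nhds 0)) := by
  have hcont : ∀ b ∈ Set.Icc (0 : ℝ) 1 \ {x | ¬ContinuousAt (upperDistribution m f) x},
      ContinuousAt (upperDistribution m f) b := fun b hb => not_not.1 hb.2
  refine ⟨{x | ¬ContinuousAt (upperDistribution m f) x},
    hm.monotone_upperDistribution.countable_not_continuousAt,
    ⟨upperDistribution m f, fun x hx =>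
      ⟨hm.tendsto_mVal_upperDistribution hCauchy (hcont x hx),
        (hcont x hx).continuousWithinAt⟩⟩,
    fun b hb ε hε => hm.exists_forall_mVal_symmDiff_sublevel_lt hCauchy (hcont b hb) hε,
    fun hτ b hb γ => ?_,
    fun b hb => hm.tendsto_mVal_symmDiff_sublevel_strict hCauchy (hcont b hb)⟩
  simp_rw [sublevel_add_singleton]
  exact hm.tendsto_mVal_symmDiff_sublevel hCauchy (hcont b hb) (hτ γ)

end SumsetMeans
end
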